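/- Let 𝒜 be a unital prime ∗-algebra over ℂ with a nontrivial projection, and let Φ: 𝒜 → 𝒜 be a map satisfying Φ(A ⋄ B ⋄ C) = Φ(A) ⋄ B ⋄ C + A ⋄ Φ(B) ⋄ C + A ⋄ B ⋄ Φ(C) for all A, B, C ∈ 𝒜, such that Φ(1) and Φ(i·1) are self-adjoint. Then for all A, B ∈ 𝒜: Φ(AB − BA*) = Φ(A)B + AΦ(B) − Φ(B)A* − BΦ(A)*. -/

import Mathlib

/-- The ∗-Jordan product `A ⋄ B = AB + BA*`. -/
def sJordan {A : Type*} [Ring A] [StarRing A] (x y : A) : A :=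
  x * y + y * star x

/-- The triple product `A ⋄ B ⋄ C = (A ⋄ B) ⋄ C`. -/
def sJordanTriple {A : Type*} [Ring A] [StarRing A] (x y z : A) : A :=
  sJordan (sJordan x y) z

theorem aux_two {A : Type*} [Ring A] [Algebra ℂ A] {x : A} (h : x + x = 0) : x = 0 := by
  have h2 : (2 : ℂ) • x = 0 := by rw [two_smul, h]
  exact (smul_eq_zero_iff_right (two_ne_zero)).1 h2

theorem aux_dec {A : Type*} [Ring A] {P Q T : A} (hs : P + Q = 1)
    (h1 : P * T * P = 0) (h2 : P * T * Q = 0) (h3 : Q * T * P = 0) (h4 : Q * T * Q = 0) :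
    T = 0 := by
  have : T = (P + Q) * T * (P + Q) := by rw [hs]; simp
  rw [this]
  simp only [add_mul, mul_add, h1, h2, h3, h4, add_zero]

/-- the triple relation gives the binary relation -/
theorem aux_binary {A : Type*} [Ring A] [Algebra ℂ A] [StarRing A] [StarModule ℂ A]
    (Φ : A → A)
    (hΦ : ∀ a b c : A, Φ (sJordanTriple a b c) =
      sJordanTriple (Φ a) b c + sJordanTriple a (Φ b) c + sJordanTriple a b (Φ c))
    (h1 : star (Φ 1) = Φ 1) (hi : star (Φ ((Complex.I : ℂ) • (1 : A))) = Φ ((Complex.I : ℂ) • (1 : A))) :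
    Φ 0 = 0 ∧ Φ ((Complex.I : ℂ) • (1 : A)) = 0 ∧
    ∀ a b : A, Φ (sJordan a b) = sJordan (Φ a) b + sJordan a (Φ b) := by
  have h0 : Φ 0 = 0 := by
    have := hΦ 0 0 0
    simpa [sJordanTriple, sJordan] using this
  have he : Φ ((Complex.I : ℂ) • (1 : A)) = 0 := by
    have := hΦ ((Complex.I : ℂ) • (1 : A)) 1 1
    simp [sJordanTriple, sJordan, h0, hi] at this
    exact aux_two (aux_two this.symm)
  have hc : ∀ c, Φ 1 * c = c * Φ 1 := by
    intro c
    have := hΦ 1 ((Complex.I : ℂ) • (1 : A)) c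
    simp [sJordanTriple, sJordan, h0, h1, he, add_mul, mul_add] at this
    have h3 : (Complex.I : ℂ) • ((Φ 1 * c - c * Φ 1) + (Φ 1 * c - c * Φ 1)) = 0 := by
      rw [this]; module
    rw [smul_eq_zero_iff_right Complex.I_ne_zero] at h3
    exact sub_eq_zero.1 (aux_two h3)
  have F : ∀ b c, Φ (sJordan b c + sJordan b c) =
      (Φ 1 * sJordan b c + sJordan (Φ b) c + sJordan b (Φ c)) +
      (Φ 1 * sJordan b c + sJordan (Φ b) c + sJordan b (Φ c)) := by
    intro b c
    have := hΦ 1 b c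
    have e1 : sJordanTriple 1 b c = sJordan b c + sJordan b c := by
      simp only [sJordanTriple, sJordan, star_one, star_add, star_mul, one_mul, mul_one]; noncomm_ring
    rw [e1] at this
    rw [this]
    simp only [sJordanTriple, sJordan, star_one, star_add, star_mul, one_mul, mul_one, h1, ← hc,
      mul_add, add_mul, mul_assoc]
    have e2 : c * (Φ 1 * star b) = Φ 1 * (c * star b) := by
      rw [← mul_assoc, ← hc, mul_assoc]
    simp only [e2]
    abel
  have hh : ∀ c, sJordan ((1/2 : ℂ) • (1 : A)) c = c := by
    intro c
    simp [sJordan]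
    module
  have hm : Φ ((1/2 : ℂ) • (1 : A)) = 0 := by
    have := F ((1/2 : ℂ) • (1 : A)) ((1/2 : ℂ) • (1 : A))
    rw [hh, hh] at this
    have e1 : ((1/2 : ℂ) • (1 : A)) + ((1/2 : ℂ) • (1 : A)) = 1 := by module
    rw [e1] at this
    generalize Φ ((1/2 : ℂ) • (1 : A)) = m at *
    simp only [sJordan, mul_smul_comm, smul_mul_assoc, mul_one, one_mul] at this
    have e2 : (3 : ℂ) • m + star m = 0 := by
      linear_combination (norm := module) (-1 : ℂ) • this
    have e3 : (3 : ℂ) • star m + m = 0 := by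
      have := congrArg star e2
      simpa using this
    have e4 : (8 : ℂ) • m = 0 := by
      linear_combination (norm := module) (3 : ℂ) • e2 - e3
    exact (smul_eq_zero_iff_right (by norm_num)).1 e4
  refine ⟨h0, he, ?_⟩
  intro a b
  have G : Φ (sJordan a b + sJordan a b) = Φ 1 * sJordan a b + Φ (sJordan a b) +
      (Φ 1 * sJordan a b + Φ (sJordan a b)) := by
    have := F ((1/2 : ℂ) • (1 : A)) (sJordan a b)
    simp only [hh, hm] at this
    rw [this]
    simp [sJordan]
  rw [F] at G
  have : ∀ x y : A, x + x = y + y → x = y := by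
    intro x y h
    refine sub_eq_zero.1 (aux_two ?_)
    rw [sub_add_sub_comm, h, sub_self]
  have := this _ _ G
  rw [add_assoc] at this
  exact (add_left_cancel this).symm

section add
variable {A : Type*} [Ring A] [Algebra ℂ A] [StarRing A] [StarModule ℂ A]

/-- additivity defect -/
def dft (Φ : A → A) (a b : A) : A := Φ (a + b) - Φ a - Φ b

theorem dft_left {Φ : A → A}
    (hJ : ∀ a b : A, Φ (sJordan a b) = sJordan (Φ a) b + sJordan a (Φ b)) (x a b : A) :
    sJordan x (dft Φ a b) = dft Φ (sJordan x a) (sJordan x b) := by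
  have e : sJordan x a + sJordan x b = sJordan x (a + b) := by
    simp only [sJordan]; noncomm_ring
  simp only [dft, e, hJ]
  simp only [sJordan]; noncomm_ring

theorem dft_right {Φ : A → A}
    (hJ : ∀ a b : A, Φ (sJordan a b) = sJordan (Φ a) b + sJordan a (Φ b)) (x a b : A) :
    sJordan (dft Φ a b) x = dft Φ (sJordan a x) (sJordan b x) := by
  have e : sJordan a x + sJordan b x = sJordan (a + b) x := by
    simp only [sJordan, star_add]; noncomm_ring
  simp only [dft, e, hJ]
  simp only [sJordan, star_sub, star_add]; noncomm_ring

theorem dft_zl {Φ : A → A} (h0 : Φ 0 = 0) (b : A) : dft Φ 0 b = 0 := by simp [dft, h0]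
theorem dft_zr {Φ : A → A} (h0 : Φ 0 = 0) (b : A) : dft Φ b 0 = 0 := by simp [dft, h0]
theorem dft_eq {Φ : A → A} {a b : A} (h : dft Φ a b = 0) : Φ (a + b) = Φ a + Φ b := by
  rw [dft, sub_sub, sub_eq_zero] at h; exact h

/-- pair of complementary projections -/
structure Pr (P Q : A) : Prop where
  sP : star P = P
  sQ : star Q = Q
  pp : P * P = P
  qq : Q * Q = Q
  pq : P * Q = 0
  qp : Q * P = 0
  s : P + Q = 1

theorem Pr.symm {P Q : A} (h : Pr P Q) : Pr Q P :=
  ⟨h.sQ, h.sP, h.qq, h.pp, h.qp, h.pq, by rw [add_comm, h.s]⟩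

theorem pp' {P : A} (h : P * P = P) (x : A) : P * (P * x) = P * x := by rw [← mul_assoc, h]
theorem pq' {P Q : A} (h : P * Q = 0) (x : A) : P * (Q * x) = 0 := by rw [← mul_assoc, h, zero_mul]

variable {Φ : A → A} {P Q : A}

theorem add_12_21 (hJ : ∀ a b : A, Φ (sJordan a b) = sJordan (Φ a) b + sJordan a (Φ b))
    (h0 : Φ 0 = 0) (h : Pr P Q) (a b : A) :
    dft Φ (P * a * Q) (Q * b * P) = 0 := by
  obtain ⟨sP, sQ, pp, qq, pq, qp, s⟩ := h
  have e1 := dft_left hJ P (P * a * Q) (Q * b * P)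
  have e2 := dft_right hJ P (P * a * Q) (Q * b * P)
  have e3 := dft_right hJ Q (P * a * Q) (Q * b * P)
  simp only [sJordan, star_mul, sP, sQ, mul_assoc, pp, qq, pq, qp, pp' pp, pp' qq, pq' pq, pq' qp,
    mul_zero, add_zero, zero_add, dft_zl h0, dft_zr h0] at e1 e2 e3
  simp only [mul_assoc]
  generalize dft Φ (P * (a * Q)) (Q * (b * P)) = T at *
  apply aux_dec s
  · have := congrArg (fun x => P * x * P) e1
    simpa [mul_add, add_mul, mul_assoc, pp, pp' pp] using this
  · have := congrArg (fun x => P * x * Q) e3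
    simpa [mul_add, add_mul, mul_assoc, pp, pp' pp, qq, pq, qp, pp' qq, pq' pq, pq' qp] using this
  · have := congrArg (fun x => Q * x * P) e2
    simpa [mul_add, add_mul, mul_assoc, pp, pp' pp, qq, pq, qp, pp' qq, pq' pq, pq' qp] using this
  · have := congrArg (fun x => Q * x * Q) e1
    simpa [eq_comm, mul_add, add_mul, mul_assoc, pp, pp' pp, qq, pq, qp, pp' qq, pq' pq, pq' qp]
      using this

theorem add_diag_off (hJ : ∀ a b : A, Φ (sJordan a b) = sJordan (Φ a) b + sJordan a (Φ b))
    (h0 : Φ 0 = 0) (h : Pr P Q) (a b c d : A) :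
    dft Φ (P * a * P + Q * b * Q) (P * c * Q + Q * d * P) = 0 := by
  obtain ⟨sP, sQ, pp, qq, pq, qp, s⟩ := h
  have e1 := dft_left hJ (P - Q) (P * a * P + Q * b * Q) (P * c * Q + Q * d * P)
  have e2 := dft_left hJ ((Complex.I : ℂ) • (P - Q)) (P * a * P + Q * b * Q) (P * c * Q + Q * d * P)
  have f1 : sJordan (P - Q) (P * c * Q + Q * d * P) = 0 := by
    simp [sJordan, sP, sQ, mul_add, add_mul, sub_mul, mul_sub, mul_assoc, pp, pp' pp, qq, pq, qp,
      pp' qq, pq' pq, pq' qp]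
    abel
  have f2 : sJordan ((Complex.I : ℂ) • (P - Q)) (P * a * P + Q * b * Q) = 0 := by
    simp [sJordan, sP, sQ, mul_add, add_mul, sub_mul, mul_sub, mul_assoc, pp, pp' pp, qq, pq, qp,
      pp' qq, pq' pq, pq' qp]
    module
  rw [f1, dft_zr h0] at e1
  rw [f2, dft_zl h0] at e2
  generalize dft Φ _ _ = T at *
  have e3 : (P - Q) * T - T * (P - Q) = 0 := by
    refine (smul_eq_zero_iff_right Complex.I_ne_zero).1 (?_ : Complex.I • ((P - Q) * T - T * (P - Q)) = 0)
    rw [← e2]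
    simp only [sJordan, star_smul, star_sub, sP, sQ, smul_mul_assoc, mul_smul_comm,
      Complex.star_def, Complex.conj_I]
    module
  simp only [sJordan, star_sub, sP, sQ] at e1
  apply aux_dec s
  · have := congrArg (fun x => P * x * P) e1
    simp [mul_add, add_mul, sub_mul, mul_sub, mul_assoc, pp, pp' pp, qq, pq, qp, pp' qq, pq' pq, pq' qp] at this
    simpa [mul_assoc] using aux_two this
  · have := congrArg (fun x => P * x * Q) e3
    simp [mul_add, add_mul, sub_mul, mul_sub, mul_assoc, pp, pp' pp, qq, pq, qp, pp' qq, pq' pq, pq' qp] at this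
    simpa [mul_assoc] using aux_two this
  · have := congrArg (fun x => Q * x * P) e3
    simp [mul_add, add_mul, sub_mul, mul_sub, mul_assoc, pp, pp' pp, qq, pq, qp, pp' qq, pq' pq, pq' qp] at this
    rw [← neg_add', neg_eq_zero] at this
    simpa [mul_assoc] using aux_two this
  · have := congrArg (fun x => Q * x * Q) e1
    simp [mul_add, add_mul, sub_mul, mul_sub, mul_assoc, pp, pp' pp, qq, pq, qp, pp' qq, pq' pq, pq' qp] at this
    rw [← neg_add, neg_eq_zero] at this
    simpa [mul_assoc] using aux_two this

/-- `P ⋄ T = 0` kills everything but the 22 part -/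
theorem kill (h : Pr P Q) {T : A} (e : sJordan P T = 0) :
    P * T * P = 0 ∧ P * T * Q = 0 ∧ Q * T * P = 0 := by
  obtain ⟨sP, sQ, pp, qq, pq, qp, s⟩ := h
  simp only [sJordan, sP] at e
  refine ⟨?_, ?_, ?_⟩
  · have := congrArg (fun x => P * x * P) e
    simp [mul_add, add_mul, mul_assoc, pp, pp' pp] at this
    simpa [mul_assoc] using aux_two this
  · have := congrArg (fun x => P * x * Q) e
    simpa [mul_add, add_mul, mul_assoc, pp, pp' pp, qq, pq, qp, pp' qq, pq' pq, pq' qp] using this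
  · have := congrArg (fun x => Q * x * P) e
    simpa [mul_add, add_mul, mul_assoc, pp, pp' pp, qq, pq, qp, pp' qq, pq' pq, pq' qp] using this

theorem add_11_22 (hJ : ∀ a b : A, Φ (sJordan a b) = sJordan (Φ a) b + sJordan a (Φ b))
    (h0 : Φ 0 = 0) (h : Pr P Q) (a b : A) :
    dft Φ (P * a * P) (Q * b * Q) = 0 := by
  have e1 := dft_left hJ P (P * a * P) (Q * b * Q)
  have e2 := dft_left hJ Q (P * a * P) (Q * b * Q)
  have f1 : sJordan P (Q * b * Q) = 0 := by
    simp [sJordan, h.sP, mul_assoc, h.qp, pq' h.pq]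
  have f2 : sJordan Q (P * a * P) = 0 := by
    simp [sJordan, h.sQ, mul_assoc, h.pq, pq' h.qp]
  rw [f1, dft_zr h0] at e1
  rw [f2, dft_zl h0] at e2
  obtain ⟨k1, k2, k3⟩ := kill h e1
  obtain ⟨k4, -, -⟩ := kill h.symm e2
  exact aux_dec h.s k1 k2 k3 k4

theorem add_dec (hJ : ∀ a b : A, Φ (sJordan a b) = sJordan (Φ a) b + sJordan a (Φ b))
    (h0 : Φ 0 = 0) (h : Pr P Q) (a b c d : A) :
    Φ ((P * a * P + Q * b * Q) + (P * c * Q + Q * d * P)) =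
      Φ (P * a * P) + Φ (Q * b * Q) + (Φ (P * c * Q) + Φ (Q * d * P)) := by
  rw [dft_eq (add_diag_off hJ h0 h a b c d), dft_eq (add_11_22 hJ h0 h a b),
    dft_eq (add_12_21 hJ h0 h c d)]

theorem add_12_12 (hJ : ∀ a b : A, Φ (sJordan a b) = sJordan (Φ a) b + sJordan a (Φ b))
    (h0 : Φ 0 = 0) (h : Pr P Q) (a b : A) :
    Φ (P * a * Q + P * b * Q) = Φ (P * a * Q) + Φ (P * b * Q) := by
  have D := add_dec hJ h0 h
  obtain ⟨sP, sQ, pp, qq, pq, qp, s⟩ := h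
  have g1 : Φ (P + P * a * Q) = Φ P + Φ (P * a * Q) := by
    have := D 1 0 a 0
    simpa [h0, pp] using this
  have g2 : Φ (Q + P * b * Q) = Φ Q + Φ (P * b * Q) := by
    have := D 0 1 b 0
    simpa [h0, qq] using this
  have main := hJ (P + P * a * Q) (Q + P * b * Q)
  rw [g1, g2] at main
  have m1 := hJ P Q
  have m2 := hJ P (P * b * Q)
  have m3 := hJ (P * a * Q) Q
  have m4 := hJ (P * a * Q) (P * b * Q)
  have tot : Φ (sJordan (P + P * a * Q) (Q + P * b * Q)) = Φ (sJordan P Q) + Φ (sJordan P (P * b * Q))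
     + Φ (sJordan (P * a * Q) Q) + Φ (sJordan (P * a * Q) (P * b * Q)) := by
    rw [main, m1, m2, m3, m4]
    simp only [sJordan, star_add]
    noncomm_ring
  have s1 : sJordan (P + P * a * Q) (Q + P * b * Q) =
      (P * (b * Q * star a) * P + Q * 0 * Q) + (P * (a + b) * Q + Q * star a * P) := by
    simp [sJordan, sP, sQ, mul_add, add_mul, mul_assoc, pp, pp' pp, qq, pq, qp, pp' qq, pq' pq, pq' qp]
    abel
  have s2 : sJordan P Q = 0 := by simp [sJordan, sP, pq, qp]
  have s3 : sJordan P (P * b * Q) = P * b * Q := by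
    simp [sJordan, sP, mul_assoc, pp' pp, qp]
  have s4 : sJordan (P * a * Q) Q =
      (P * 0 * P + Q * 0 * Q) + (P * a * Q + Q * star a * P) := by
    simp [sJordan, sP, sQ, mul_assoc, pp' qq, qq]
  have s5 : sJordan (P * a * Q) (P * b * Q) = P * (b * Q * star a) * P := by
    simp [sJordan, sP, sQ, mul_assoc, pp' qq, qq, pq' qp]
  rw [s1, D, s2, s3, s4, D, s5] at tot
  simp only [mul_zero, zero_mul, h0, zero_add, add_zero] at tot
  rw [← add_mul, ← mul_add]
  have : Φ (P * (a + b) * Q) + (Φ (Q * star a * P) + Φ (P * (b * Q * star a) * P)) =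
    (Φ (P * a * Q) + Φ (P * b * Q)) + (Φ (Q * star a * P) + Φ (P * (b * Q * star a) * P)) := by
    convert tot using 1 <;> abel
  exact add_right_cancel this

theorem add_off (hJ : ∀ a b : A, Φ (sJordan a b) = sJordan (Φ a) b + sJordan a (Φ b))
    (h0 : Φ 0 = 0) (h : Pr P Q) (a b c d : A) :
    dft Φ (P * a * Q + Q * b * P) (P * c * Q + Q * d * P) = 0 := by
  have e : (P * a * Q + Q * b * P) + (P * c * Q + Q * d * P) =
    P * (a + c) * Q + Q * (b + d) * P := by noncomm_ring
  rw [dft, e, dft_eq (add_12_21 hJ h0 h _ _), dft_eq (add_12_21 hJ h0 h _ _),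
    dft_eq (add_12_21 hJ h0 h _ _), mul_add, add_mul, mul_add, add_mul, add_12_12 hJ h0 h,
    add_12_12 hJ h0 h.symm]
  abel

theorem add_11_11 (hprime : ∀ a b : A, (∀ x : A, a * x * b = 0) → a = 0 ∨ b = 0)
    (hJ : ∀ a b : A, Φ (sJordan a b) = sJordan (Φ a) b + sJordan a (Φ b))
    (h0 : Φ 0 = 0) (h : Pr P Q) (hQ : Q ≠ 0) (a b : A) :
    Φ (P * a * P + P * b * P) = Φ (P * a * P) + Φ (P * b * P) := by
  apply dft_eq
  have e2 := dft_left hJ Q (P * a * P) (P * b * P)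
  have f2 : ∀ a, sJordan Q (P * a * P) = 0 := by
    intro a
    simp [sJordan, h.sQ, mul_assoc, h.pq, pq' h.qp]
  rw [f2, dft_zl h0] at e2
  obtain ⟨k4, k2, k3⟩ := kill h.symm e2
  refine aux_dec h.s ?_ k3 k2 k4
  refine ((hprime Q _ ?_).resolve_left hQ)
  intro x
  have e1 := dft_left hJ (Q * x * P) (P * a * P) (P * b * P)
  have O := add_off hJ h0 h
  obtain ⟨sP, sQ, pp, qq, pq, qp, s⟩ := h
  have f1 : ∀ a, sJordan (Q * x * P) (P * a * P) =
      P * (a * P * star x) * Q + Q * (x * P * a) * P := by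
    intro a
    simp [sJordan, sP, sQ, mul_assoc, pp' pp]
    abel
  rw [f1, f1, O] at e1
  generalize dft Φ _ _ = T at *
  have := congrArg (fun x => Q * x * P) e1
  simp [sJordan, sP, sQ, mul_add, add_mul, mul_assoc, pp, pp' pp, qq, pq, qp, pp' qq, pq' pq, pq' qp] at this
  simpa [mul_assoc] using this

theorem add_all (hprime : ∀ a b : A, (∀ x : A, a * x * b = 0) → a = 0 ∨ b = 0)
    (hJ : ∀ a b : A, Φ (sJordan a b) = sJordan (Φ a) b + sJordan a (Φ b))
    (h0 : Φ 0 = 0) (h : Pr P Q) (hP : P ≠ 0) (hQ : Q ≠ 0) (a b : A) :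
    Φ (a + b) = Φ a + Φ b := by
  have D : ∀ x, Φ x = Φ (P * x * P) + Φ (Q * x * Q) + (Φ (P * x * Q) + Φ (Q * x * P)) := by
    intro x
    rw [← add_dec hJ h0 h]
    congr 1
    calc x = (P + Q) * x * (P + Q) := by rw [h.s]; simp
      _ = _ := by noncomm_ring
  rw [D (a + b), D a, D b]
  simp only [mul_add, add_mul]
  rw [add_11_11 hprime hJ h0 h hQ, add_11_11 hprime hJ h0 h.symm hP, add_12_12 hJ h0 h,
    add_12_12 hJ h0 h.symm]
  abel

end add

theorem stmt13 {A : Type*} [Ring A] [Algebra ℂ A] [StarRing A] [StarModule ℂ A]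
    (hprime : ∀ a b : A, (∀ x : A, a * x * b = 0) → a = 0 ∨ b = 0)
    (hproj : ∃ P : A, star P = P ∧ P * P = P ∧ P ≠ 0 ∧ P ≠ 1)
    (Φ : A → A)
    (hΦ : ∀ a b c : A, Φ (sJordanTriple a b c) =
      sJordanTriple (Φ a) b c + sJordanTriple a (Φ b) c + sJordanTriple a b (Φ c))
    (h1 : star (Φ 1) = Φ 1) (hi : star (Φ ((Complex.I : ℂ) • (1 : A))) = Φ ((Complex.I : ℂ) • (1 : A))) :
    ∀ a b : A, Φ (a * b - b * star a) =
      Φ a * b + a * Φ b - Φ b * star a - b * star (Φ a) := by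
  obtain ⟨h0, he, hJ⟩ := aux_binary Φ hΦ h1 hi
  obtain ⟨P, sP, pp, hP, hP1⟩ := hproj
  have h : Pr P (1 - P) :=
    ⟨sP, by simp [sP], pp, by simp [mul_sub, sub_mul, pp], by simp [mul_sub, pp],
      by simp [sub_mul, pp], by abel⟩
  have hadd := add_all hprime hJ h0 h hP (sub_ne_zero.2 hP1.symm)
  have hneg : ∀ x, Φ (-x) = - Φ x := by
    intro x
    have := hadd x (-x)
    rw [add_neg_cancel, h0] at this
    exact (neg_eq_of_add_eq_zero_right this.symm).symm
  have hI : ∀ x, Φ (Complex.I • (x + star x)) = Complex.I • (Φ x + star (Φ x)) := by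
    intro x
    have := hJ x (Complex.I • 1)
    simp only [he] at this
    simpa [sJordan] using this
  have hd : Φ 1 = 0 := by
    have := hJ 1 1
    simp only [sJordan, star_one, mul_one, one_mul, h1, hadd] at this
    exact aux_two (left_eq_add.1 this)
  have hstar : ∀ x, Φ (x + star x) = Φ x + star (Φ x) := by
    intro x
    have := hJ x 1
    simpa [sJordan, hd] using this
  -- self-adjoint elements
  have hIs : ∀ x, Φ (Complex.I • (x + star x)) = Complex.I • Φ (x + star x) := by
    intro x; rw [hI, hstar]
  have hIall : ∀ x, Φ (Complex.I • x) = Complex.I • Φ x := by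
    intro x
    -- 2 x = (x + x*) - I (y + y*), y = I x
    have e1 := hIs x
    have e2 := hIs (Complex.I • x)
    have e3 : Complex.I • (Complex.I • x + star (Complex.I • x)) = -x + star x := by
      simp [smul_smul]
    rw [e3] at e2
    simp only [star_smul, smul_add, hadd, hneg] at e1 e2
    have e4 : Complex.I • star x = - (star Complex.I • star x) := by simp
    rw [e4, hneg] at e1
    have e5 : (2 : ℂ) • (Φ (Complex.I • x) - Complex.I • Φ x) = 0 := by
      have e6 := congrArg (fun z => Complex.I • z) e2
      simp only [smul_add, smul_neg, smul_smul, Complex.I_mul_I, neg_smul, one_smul] at e6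
      linear_combination (norm := module) e1 + e6
    exact sub_eq_zero.1 ((smul_eq_zero_iff_right two_ne_zero).1 e5)
  intro a b
  have := hJ (Complex.I • a) b
  have e : sJordan (Complex.I • a) b = Complex.I • (a * b - b * star a) := by
    simp [sJordan, smul_sub, sub_eq_add_neg]
  rw [e, hIall, hIall] at this
  have e7 : sJordan (Complex.I • Φ a) b + sJordan (Complex.I • a) (Φ b) =
    Complex.I • (Φ a * b + a * Φ b - Φ b * star a - b * star (Φ a)) := by
    simp [sJordan, smul_sub, smul_add, sub_eq_add_neg]
    abel
  rw [e7] at this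
  exact smul_right_injective A Complex.I_ne_zero this
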